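/- Proposition 2.2 (trivial estimate for the piece D^k_*). There exists a constant C > 0, depending only on n, s, γ, C_Φ and c_b, such that for every kernel b satisfying the standing kernel assumptions, every measurable g satisfying Assumption U with constant C_g > 0, all measurable f, h : ℝⁿ → ℝ, every k ∈ ℤ, and every measurable χ : ℝ → [0,1] vanishing outside the interval [2^{-k-1}, 2^{-k}], one has ∫∫∫ B(v-v_*,σ) χ(|v'-v|) |g(v_*)| |f(v') h(v')| dσ dv_* dv ≤ C · C_g · 2^{2sk} · |f|_{L²_{γ+2s}} |h|_{L²_{γ+2s}}, as an inequality of values in [0,∞]. -/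

import Mathlib

open MeasureTheory Real Set Metric
open scoped ENNReal RealInnerProductSpace

noncomputable section

/-- `ℝⁿ` with the Euclidean structure. -/
abbrev V (n : ℕ) := EuclideanSpace ℝ (Fin n)

/-- the Japanese bracket `⟨v⟩ = √(1+|v|²)`. -/
def jap {n : ℕ} (v : V n) : ℝ := Real.sqrt (1 + ‖v‖ ^ 2)

/-- the post-collisional velocity `v' = (v+v_*)/2 + (|v-v_*|/2)σ`. -/
def vprime {n : ℕ} (v vs σ : V n) : V n :=
  (2:ℝ)⁻¹ • (v + vs) + (‖v - vs‖ / 2) • σ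

/-- the anisotropic metric `d(v,v') = √(|v-v'|² + ¼(|v|²-|v'|²)²)` on the lifted paraboloid. -/
def anisoDist {n : ℕ} (v v' : V n) : ℝ :=
  Real.sqrt (‖v - v'‖ ^ 2 + 4⁻¹ * (‖v‖ ^ 2 - ‖v'‖ ^ 2) ^ 2)

/-- The standing assumptions on the angular kernel `b`: measurability, nonnegativity,
vanishing for deviation angles `θ ∈ (π/2, π]`, and the two-sided power bound
`c_b θ^{-(1+2s)} ≤ sin^{n-2}θ · b(cos θ) ≤ c_b⁻¹ θ^{-(1+2s)}` on `(0, π/2]`. -/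
def KernelAssumptions (n : ℕ) (s cb : ℝ) (b : ℝ → ℝ) : Prop :=
  Measurable b ∧ (∀ t : ℝ, 0 ≤ b t) ∧
  (∀ θ : ℝ, θ ∈ Set.Ioc (π / 2) π → b (Real.cos θ) = 0) ∧
  (∀ θ : ℝ, θ ∈ Set.Ioc 0 (π / 2) →
    cb * θ ^ (-(1 + 2 * s)) ≤ Real.sin θ ^ ((n : ℝ) - 2) * b (Real.cos θ) ∧
    Real.sin θ ^ ((n : ℝ) - 2) * b (Real.cos θ) ≤ cb⁻¹ * θ ^ (-(1 + 2 * s)))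

/-- The Boltzmann collision kernel `B(v-v_*,σ) = C_Φ |v-v_*|^γ b(⟨(v-v_*)/|v-v_*|, σ⟩)`. -/
def Bker {n : ℕ} (CΦ γ : ℝ) (b : ℝ → ℝ) (v vs σ : V n) : ℝ :=
  CΦ * ‖v - vs‖ ^ γ * b ⟪‖v - vs‖⁻¹ • (v - vs), σ⟫

/-- the surface measure on the unit sphere `S^{n-1}`. -/
def sphMeas (n : ℕ) : Measure (Metric.sphere (0 : V n) 1) :=
  (volume : Measure (V n)).toSphere

/-- the weighted squared `L²` norm `|f|²_{L²_ℓ}`, as a value in `[0,∞]`. -/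
def L2e {n : ℕ} (ℓ : ℝ) (f : V n → ℝ) : ℝ≥0∞ :=
  ∫⁻ v : V n, ENNReal.ofReal (jap v ^ ℓ * f v ^ 2)

/-- Assumption U: with `i = 1` for `s ∈ (0,1/2)` and `i = 2` for `s ∈ [1/2,1)`,
`∫ |v-v_*|^a ⟨v_*⟩^i |g(v_*)| dv_* ≤ C_g ⟨v⟩^a` for all `v` and all `a ∈ [γ, γ+2s]`. -/
def AssumptionU {n : ℕ} (s γ Cg : ℝ) (g : V n → ℝ) : Prop :=
  ∀ v : V n, ∀ a ∈ Set.Icc γ (γ + 2 * s),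
    (∫⁻ vs : V n, ENNReal.ofReal
        (‖v - vs‖ ^ a * jap vs ^ (if s < 2⁻¹ then (1:ℝ) else 2) * |g vs|)) ≤
      ENNReal.ofReal (Cg * jap v ^ a)


lemma cap_bound (n : ℕ) (hn : 2 ≤ n) (e : V n) (he : ‖e‖ = 1) (δ : ℝ) (hδ : 0 < δ) :
    sphMeas n {σ | ‖(σ : V n) - e‖ ≤ δ} ≤
      ENNReal.ofReal (2 ^ n * (volume (ball (0 : V n) 1)).toReal * δ ^ (n - 1)) := by
  have : Nontrivial (V n) := ⟨⟨e, 0, ne_of_apply_ne Norm.norm (by simp [he])⟩⟩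
  have : Nonempty (Fin n) := ⟨⟨0, by omega⟩⟩
  set S : Set (Metric.sphere (0 : V n) 1) := {σ | ‖(σ : V n) - e‖ ≤ δ} with hS
  have hSm : MeasurableSet S := by
    apply measurableSet_le <;> fun_prop
  set R : Set (Ioi (0:ℝ)) := {r | 1 ≤ r.1 ∧ r.1 ≤ 1 + δ} with hR
  have hRm : MeasurableSet R := by
    have h1 : MeasurableSet {r : Ioi (0:ℝ) | 1 ≤ r.1} := by
      apply measurableSet_le <;> fun_prop
    have h2 : MeasurableSet {r : Ioi (0:ℝ) | r.1 ≤ 1 + δ} := by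
      apply measurableSet_le <;> fun_prop
    exact h1.inter h2
  have hmp := (volume : Measure (V n)).measurePreserving_homeomorphUnitSphereProd
  have h1 := hmp.measure_preimage (hSm.prod hRm).nullMeasurableSet
  rw [Measure.prod_prod] at h1
  have h2 : ENNReal.ofReal δ ≤ Measure.volumeIoiPow (Module.finrank ℝ (V n) - 1) R := by
    rw [Measure.volumeIoiPow, withDensity_apply _ hRm]
    calc ENNReal.ofReal δ = ∫⁻ r in R, 1 ∂(Measure.comap Subtype.val volume) := by
          rw [setLIntegral_one, comap_subtype_coe_apply measurableSet_Ioi]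
          have : Subtype.val '' R = Icc 1 (1 + δ) := by
            ext x
            simp only [hR, mem_image, mem_ofPred_eq, Subtype.exists, mem_Ioi, mem_Icc]
            constructor
            · rintro ⟨a, _, h, rfl⟩; exact h
            · intro h; exact ⟨x, by linarith [h.1], h, rfl⟩
          rw [this, Real.volume_Icc]; congr 1; ring
      _ ≤ _ := by
          apply setLIntegral_mono' hRm
          intro r hr
          rw [ENNReal.one_le_ofReal]
          exact one_le_pow₀ hr.1
  have h3 : Measure.comap Subtype.val (volume : Measure (V n))
      (homeomorphUnitSphereProd (V n) ⁻¹' S ×ˢ R) ≤ volume (closedBall e (2 * δ)) := by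
    rw [comap_subtype_coe_apply (measurableSet_singleton _).compl]
    apply measure_mono
    rintro _ ⟨x, ⟨hx1, hx2⟩, rfl⟩
    simp only [hS, hR, mem_ofPred_eq, homeomorphUnitSphereProd_apply_fst_coe,
      homeomorphUnitSphereProd_apply_snd_coe] at hx1 hx2
    rw [mem_closedBall, dist_eq_norm]
    have hx0 : 0 < ‖(x : V n)‖ := by linarith
    have : (x : V n) - e = (‖(x : V n)‖ - 1) • (‖(x : V n)‖⁻¹ • (x : V n))
        + (‖(x : V n)‖⁻¹ • (x : V n) - e) := by
      rw [sub_smul, smul_smul, mul_inv_cancel₀ hx0.ne']; simp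
    rw [this]
    refine (norm_add_le _ _).trans ?_
    rw [norm_smul, norm_smul, norm_inv, norm_norm, inv_mul_cancel₀ hx0.ne', Real.norm_eq_abs,
      abs_of_nonneg (by linarith)]
    linarith
  rw [h1] at h3
  have h4 : volume (closedBall e (2 * δ)) = ENNReal.ofReal ((2 * δ) ^ n) * volume (ball (0 : V n) 1) := by
    rw [Measure.addHaar_closedBall _ _ (by positivity)]; simp
  have h5 : sphMeas n S * ENNReal.ofReal δ ≤
      ENNReal.ofReal (2 ^ n * (volume (ball (0 : V n) 1)).toReal * δ ^ (n - 1)) * ENNReal.ofReal δ := by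
    calc _ ≤ _ := mul_le_mul' le_rfl h2
      _ ≤ _ := h3
      _ = _ := by
        rw [h4, ← ENNReal.ofReal_toReal (a := volume (ball (0 : V n) 1)) measure_ball_lt_top.ne,
          ← ENNReal.ofReal_mul (by positivity), ← ENNReal.ofReal_mul (by positivity),
          ENNReal.toReal_ofReal (by positivity)]
        congr 1
        have : δ ^ n = δ ^ (n - 1) * δ := by
          rw [← pow_succ]; congr 1; omega
        rw [mul_pow, this]; ring
  exact (ENNReal.mul_le_mul_iff_left (by simpa using hδ) (by simp)).1 h5


lemma T_deriv {n : ℕ} (σ u : V n) (hu : u ≠ 0) :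
    HasFDerivAt (fun u : V n => (2:ℝ)⁻¹ • (u + ‖u‖ • σ))
      ((2:ℝ)⁻¹ • (ContinuousLinearMap.id ℝ (V n) + (‖u‖⁻¹ • innerSL ℝ u).smulRight σ)) u := by
  have h1 : HasFDerivAt (fun u : V n => ‖u‖) (‖u‖⁻¹ • innerSL ℝ u) u := by
    have h := (hasStrictFDerivAt_norm_sq u).hasFDerivAt.sqrt (by simpa using hu)
    simp only [norm_nonneg, Real.sqrt_sq] at h
    have e : ‖u‖⁻¹ • innerSL ℝ u = (1 / (2 * ‖u‖)) • 2 • (innerSL ℝ) u := by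
      rw [two_smul, ← two_smul ℝ, smul_smul]
      congr 1
      field_simp
    rw [e]
    exact h
  have h2 := ((hasFDerivAt_id u).add (h1.smul_const σ)).const_smul (2:ℝ)⁻¹
  exact h2

lemma T_det {n : ℕ} (σ u : V n) :
    ((2:ℝ)⁻¹ • (ContinuousLinearMap.id ℝ (V n) + (‖u‖⁻¹ • innerSL ℝ u).smulRight σ)).det
      = (2⁻¹) ^ n * (1 + ‖u‖⁻¹ * ⟪u, σ⟫) := by
  rw [ContinuousLinearMap.det]
  have : (((2:ℝ)⁻¹ • (ContinuousLinearMap.id ℝ (V n) + (‖u‖⁻¹ • innerSL ℝ u).smulRight σ) :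
      V n →L[ℝ] V n) : V n →ₗ[ℝ] V n) =
      (2:ℝ)⁻¹ • LinearMap.transvection ((‖u‖⁻¹ • innerSL ℝ u : V n →L[ℝ] ℝ) : V n →ₗ[ℝ] ℝ) σ := by
    ext x : 1
    simp [LinearMap.transvection.apply]
  rw [this, LinearMap.det_smul, LinearMap.transvection.det]
  simp

lemma T_norm_sq {n : ℕ} (σ u : V n) (hσ : ‖σ‖ = 1) :
    ‖(2:ℝ)⁻¹ • (u + ‖u‖ • σ)‖ ^ 2 = 2⁻¹ * (‖u‖ ^ 2 + ‖u‖ * ⟪u, σ⟫) := by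
  rw [norm_smul, mul_pow, norm_add_sq_real, inner_smul_right, norm_smul, hσ]
  simp; ring

lemma T_inner {n : ℕ} (σ u : V n) (hσ : ‖σ‖ = 1) :
    ⟪(2:ℝ)⁻¹ • (u + ‖u‖ • σ), σ⟫ = 2⁻¹ * (‖u‖ + ⟪u, σ⟫) := by
  rw [inner_smul_left, inner_add_left, inner_smul_left, real_inner_self_eq_norm_sq, hσ]
  simp; ring

lemma cov {n : ℕ} (σ : V n) (hσ : ‖σ‖ = 1) (F : V n → ℝ≥0∞) :
    ∫⁻ u in {u : V n | u ≠ 0 ∧ 0 ≤ ⟪u, σ⟫}, F ((2:ℝ)⁻¹ • (u + ‖u‖ • σ)) ≤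
      2 ^ n * ∫⁻ w, F w := by
  set S : Set (V n) := {u : V n | u ≠ 0 ∧ 0 ≤ ⟪u, σ⟫} with hS
  have hSm : MeasurableSet S := by
    have h1 : MeasurableSet {u : V n | 0 ≤ ⟪u, σ⟫} := by
      apply measurableSet_le <;> fun_prop
    exact (measurableSet_singleton (0 : V n)).compl.inter h1
  have hinj : InjOn (fun u : V n => (2:ℝ)⁻¹ • (u + ‖u‖ • σ)) S := by
    intro u hu u' hu' h
    simp only at h
    have hn1 : 0 < ‖u‖ := norm_pos_iff.2 hu.1
    have hn2 : 0 < ‖u'‖ := norm_pos_iff.2 hu'.1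
    have h1 := T_norm_sq σ u hσ
    have h2 := T_inner σ u hσ
    rw [h, T_norm_sq σ u' hσ] at h1
    rw [h, T_inner σ u' hσ] at h2
    have hp := hu.2
    have hp' := hu'.2
    have hne : ‖u‖ = ‖u'‖ := by
      have h3 : ‖u'‖ + ⟪u', σ⟫ = ‖u‖ + ⟪u, σ⟫ := by linarith
      have h4 : ‖u'‖ * (‖u'‖ + ⟪u', σ⟫) = ‖u‖ * (‖u‖ + ⟪u, σ⟫) := by nlinarith
      rw [h3] at h4
      exact (mul_right_cancel₀ (by positivity) h4).symm
    rw [hne] at h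
    have := smul_right_injective (V n) (r := (2:ℝ)⁻¹) (by norm_num) h
    simpa using this
  have key := lintegral_image_eq_lintegral_abs_det_fderiv_mul volume hSm
    (fun u hu => (T_deriv σ u hu.1).hasFDerivWithinAt) hinj F
  calc ∫⁻ u in S, F ((2:ℝ)⁻¹ • (u + ‖u‖ • σ))
      ≤ ∫⁻ u in S, 2 ^ n * (ENNReal.ofReal |((2:ℝ)⁻¹ • (ContinuousLinearMap.id ℝ (V n) + (‖u‖⁻¹ • innerSL ℝ u).smulRight σ)).det| * F ((2:ℝ)⁻¹ • (u + ‖u‖ • σ))) := by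
        apply setLIntegral_mono' hSm
        intro u hu
        rw [T_det, ← mul_assoc]
        refine le_mul_of_one_le_left' ?_
        have h0 : 0 ≤ ‖u‖⁻¹ * ⟪u, σ⟫ := mul_nonneg (by positivity) hu.2
        rw [abs_of_nonneg (by positivity)]
        have : (2:ℝ≥0∞) ^ n = ENNReal.ofReal (2 ^ n) := by
          rw [ENNReal.ofReal_pow (by norm_num)]; simp
        rw [this, ← ENNReal.ofReal_mul (by positivity), ENNReal.one_le_ofReal, ← mul_assoc,
          ← mul_pow]
        norm_num
        exact h0
    _ = 2 ^ n * ∫⁻ w in (fun u : V n => (2:ℝ)⁻¹ • (u + ‖u‖ • σ)) '' S, F w := by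
        rw [key, lintegral_const_mul' _ _ (by simp)]
    _ ≤ _ := by gcongr; exact Measure.restrict_le_self


open Classical in
lemma pointwise_bound {n : ℕ} (hn : 2 ≤ n) {s γ cb : ℝ} (hs : s ∈ Set.Ioo (0:ℝ) 1)
    (hcb : 0 < cb) {b : ℝ → ℝ} (hb : KernelAssumptions n s cb b) {D : ℝ} (hD : 0 < D)
    {χ : ℝ → ℝ} (hχ : ∀ t, χ t ∈ Set.Icc (0:ℝ) 1) (hχ0 : ∀ t, t ∉ Set.Icc (D / 2) D → χ t = 0)
    (u σ w : V n) (hσ : ‖σ‖ = 1) (hw : w = (2:ℝ)⁻¹ • (u + ‖u‖ • σ)) :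
    ‖u‖ ^ γ * b ⟪‖u‖⁻¹ • u, σ⟫ * χ ‖w - u‖ ≤
      if (u ≠ 0 ∧ 0 ≤ ⟪u, σ⟫) ∧ ‖‖w‖ • σ - w‖ ≤ 2 * D then
        2 ^ |γ| * cb⁻¹ * ‖w‖ ^ γ * (4 * ‖w‖ / D) ^ ((n:ℝ) - 1 + 2 * s) else 0 := by
  have hR : 0 ≤ (if (u ≠ 0 ∧ 0 ≤ ⟪u, σ⟫) ∧ ‖‖w‖ • σ - w‖ ≤ 2 * D then
        2 ^ |γ| * cb⁻¹ * ‖w‖ ^ γ * (4 * ‖w‖ / D) ^ ((n:ℝ) - 1 + 2 * s) else 0) := by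
    split_ifs <;> positivity
  by_cases ht : ‖w - u‖ ∈ Set.Icc (D / 2) D
  swap
  · rw [hχ0 _ ht]; simpa using hR
  obtain ⟨hbm, hb0, hb1, hb2⟩ := hb
  have htpos : 0 < ‖w - u‖ := by linarith [ht.1]
  have hu : u ≠ 0 := by
    rintro rfl
    simp [hw] at htpos
  have hr : 0 < ‖u‖ := norm_pos_iff.2 hu
  have hin : ⟪‖u‖⁻¹ • u, σ⟫ = ‖u‖⁻¹ * ⟪u, σ⟫ := by rw [inner_smul_left]; simp
  set p : ℝ := ‖u‖⁻¹ * ⟪u, σ⟫ with hp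
  have hup : ⟪u, σ⟫ = ‖u‖ * p := by rw [hp]; field_simp
  have habs := abs_le.1 (abs_real_inner_le_norm u σ)
  rw [hσ, mul_one, hup] at habs
  have hp1 : p ≤ 1 := by nlinarith [habs.2]
  have hp2 : -1 ≤ p := by nlinarith [habs.1]
  rw [hin]
  by_cases hp0 : p < 0
  · have : b p = 0 := by
      rw [← Real.cos_arccos hp2 hp1]
      apply hb1
      refine ⟨?_, Real.arccos_le_pi _⟩
      by_contra hcon
      exact absurd (Real.arccos_le_pi_div_two.1 (not_lt.1 hcon)) (not_le.2 hp0)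
    rw [this]; simpa using hR
  push Not at hp0
  have hw2 : ‖w‖ ^ 2 = 2⁻¹ * (‖u‖ ^ 2 + ‖u‖ * (‖u‖ * p)) := by
    rw [hw, T_norm_sq σ u hσ, hup]
  have hwu : ‖u‖ • σ - w = w - u := by
    rw [hw]
    module
  have ht2 : ‖w - u‖ ^ 2 = ‖u‖ ^ 2 * (1 - p) / 2 := by
    have : w - u = (2:ℝ)⁻¹ • (‖u‖ • σ - u) := by rw [hw]; module
    rw [this, norm_smul, mul_pow, norm_sub_sq_real, inner_smul_left, real_inner_comm, norm_smul,
      hσ, hup]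
    simp; ring
  have hwr : ‖w‖ ≤ ‖u‖ := by
    apply le_of_sq_le_sq _ hr.le
    nlinarith [mul_nonneg (sq_nonneg ‖u‖) (sub_nonneg.2 hp1)]
  have hrw : ‖u‖ ≤ 2 * ‖w‖ := by
    apply le_of_sq_le_sq _ (by positivity)
    nlinarith [mul_nonneg (sq_nonneg ‖u‖) hp0]
  have hwpos : 0 < ‖w‖ := by linarith
  have hcap : ‖‖w‖ • σ - w‖ ≤ 2 * D := by
    have e : ‖w‖ • σ - w = (‖w‖ - ‖u‖) • σ + (‖u‖ • σ - w) := by module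
    rw [e, hwu]
    refine (norm_add_le _ _).trans ?_
    rw [norm_smul, hσ, mul_one, Real.norm_eq_abs]
    linarith [abs_norm_sub_norm_le w u, ht.2]
  rw [if_pos ⟨⟨hu, by rw [hup]; positivity⟩, hcap⟩]
  -- the angle
  have hplt : p < 1 := by
    by_contra hcon
    have : p = 1 := le_antisymm hp1 (not_lt.1 hcon)
    rw [this] at ht2
    nlinarith
  set θ := Real.arccos p with hθ
  have hθ0 : 0 < θ := Real.arccos_pos.2 hplt
  have hθ1 : θ ≤ π / 2 := Real.arccos_le_pi_div_two.2 hp0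
  have hbb := (hb2 θ ⟨hθ0, hθ1⟩).2
  rw [hθ, Real.cos_arccos hp2 hp1, ← hθ] at hbb
  set x := ‖w - u‖ / ‖u‖ with hx
  have hx0 : 0 < x := by positivity
  have hxs : x ≤ Real.sin θ := by
    rw [hθ, Real.sin_arccos]
    apply Real.le_sqrt_of_sq_le
    rw [hx, div_pow, ht2]
    field_simp
    nlinarith
  have hxθ : x ≤ θ := hxs.trans (Real.sin_le hθ0.le)
  have hn2 : (0:ℝ) ≤ (n:ℝ) - 2 := by
    have : (2:ℝ) ≤ n := by exact_mod_cast hn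
    linarith
  have hbx : x ^ ((n:ℝ) - 2) * b p ≤ cb⁻¹ * x ^ (-(1 + 2 * s)) := by
    calc _ ≤ Real.sin θ ^ ((n:ℝ) - 2) * b p :=
          mul_le_mul_of_nonneg_right (Real.rpow_le_rpow hx0.le hxs hn2) (hb0 p)
      _ ≤ _ := hbb
      _ ≤ _ := by
          apply mul_le_mul_of_nonneg_left _ (by positivity)
          exact Real.rpow_le_rpow_of_nonpos hx0 hxθ (by linarith [hs.1])
  have hm0 : 0 ≤ (n:ℝ) - 1 + 2 * s := by linarith [hs.1]
  have hbp : b p ≤ cb⁻¹ * (4 * ‖w‖ / D) ^ ((n:ℝ) - 1 + 2 * s) := by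
    calc b p = x ^ (-((n:ℝ) - 2)) * (x ^ ((n:ℝ) - 2) * b p) := by
          rw [← mul_assoc, ← Real.rpow_add hx0]; simp
      _ ≤ x ^ (-((n:ℝ) - 2)) * (cb⁻¹ * x ^ (-(1 + 2 * s))) := by gcongr
      _ = cb⁻¹ * x ^ (-((n:ℝ) - 1 + 2 * s)) := by
          rw [mul_left_comm, ← Real.rpow_add hx0]; ring_nf
      _ = cb⁻¹ * (x⁻¹) ^ ((n:ℝ) - 1 + 2 * s) := by
          rw [Real.rpow_neg hx0.le, Real.inv_rpow hx0.le]
      _ ≤ _ := by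
          gcongr
          rw [hx, inv_div, div_le_div_iff₀ htpos hD]
          nlinarith [ht.1]
  have hrγ : ‖u‖ ^ γ ≤ 2 ^ |γ| * ‖w‖ ^ γ := by
    have e : ‖u‖ = (‖u‖ / ‖w‖) * ‖w‖ := by field_simp
    have h1 : 1 ≤ ‖u‖ / ‖w‖ := by rwa [le_div_iff₀ hwpos, one_mul]
    have h2 : ‖u‖ / ‖w‖ ≤ 2 := by rwa [div_le_iff₀ hwpos]
    rw [e, Real.mul_rpow (by positivity) (by positivity)]
    gcongr
    calc _ ≤ (‖u‖ / ‖w‖) ^ |γ| := Real.rpow_le_rpow_of_exponent_le h1 (le_abs_self _)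
      _ ≤ _ := by gcongr
  calc ‖u‖ ^ γ * b p * χ ‖w - u‖ ≤ ‖u‖ ^ γ * b p * 1 := by
        apply mul_le_mul_of_nonneg_left (hχ _).2
        exact mul_nonneg (by positivity) (hb0 p)
    _ ≤ (2 ^ |γ| * ‖w‖ ^ γ) * (cb⁻¹ * (4 * ‖w‖ / D) ^ ((n:ℝ) - 1 + 2 * s)) := by
        rw [mul_one]
        exact mul_le_mul hrγ hbp (hb0 p) (by positivity)
    _ = _ := by ring


lemma jap_pos {n : ℕ} (v : V n) : 0 < jap v := Real.sqrt_pos.2 (by positivity)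

lemma one_le_jap {n : ℕ} (v : V n) : 1 ≤ jap v := by
  rw [jap, Real.one_le_sqrt]; nlinarith [sq_nonneg ‖v‖]

lemma jap_meas {n : ℕ} : Measurable (jap : V n → ℝ) := by unfold jap; fun_prop

lemma cs_bound {n : ℕ} (ℓ : ℝ) (f h : V n → ℝ) (hf : Measurable f) (hh : Measurable h) :
    ∫⁻ w : V n, ENNReal.ofReal |f w * h w| * ENNReal.ofReal (jap w ^ ℓ) ≤
      L2e ℓ f ^ (2⁻¹ : ℝ) * L2e ℓ h ^ (2⁻¹ : ℝ) := by
  have hm := jap_meas (n := n)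
  have key := ENNReal.lintegral_mul_le_Lp_mul_Lq (volume : Measure (V n))
    (Real.HolderConjugate.two_two)
    (f := fun w => ENNReal.ofReal (jap w ^ (ℓ / 2) * |f w|))
    (g := fun w => ENNReal.ofReal (jap w ^ (ℓ / 2) * |h w|))
    (by fun_prop) (by fun_prop)
  have e : ∀ f : V n → ℝ, ∫⁻ w, ENNReal.ofReal (jap w ^ (ℓ / 2) * |f w|) ^ (2:ℝ) = L2e ℓ f := by
    intro f
    unfold L2e
    congr 1; ext w
    rw [ENNReal.ofReal_rpow_of_nonneg (by have := jap_pos w; positivity) (by norm_num)]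
    congr 1
    rw [Real.rpow_two, mul_pow, sq_abs, ← Real.rpow_two, ← Real.rpow_mul (jap_pos w).le]
    congr 2; ring
  rw [e, e, one_div] at key
  refine le_trans (le_of_eq ?_) key
  congr 1; ext w
  have := jap_pos w
  rw [Pi.mul_apply, ← ENNReal.ofReal_mul (by positivity), ← ENNReal.ofReal_mul (by positivity)]
  congr 1
  have e2 : jap w ^ ℓ = jap w ^ (ℓ / 2) * jap w ^ (ℓ / 2) := by
    rw [← Real.rpow_add this]; congr 1; ring
  rw [e2, abs_mul]; ring

instance sphMeas_fin (n : ℕ) : IsFiniteMeasure (sphMeas n) := by unfold sphMeas; infer_instance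

lemma swap_step {n : ℕ} (Φ : V n × Metric.sphere (0 : V n) 1 → ℝ≥0∞) (hΦ : Measurable Φ)
    (G φ : V n → ℝ≥0∞) (hG : Measurable G) (hφ : Measurable φ) :
    ∫⁻ v : V n, ∫⁻ vs : V n, ∫⁻ σ : Metric.sphere (0 : V n) 1,
      G vs * ({u : V n | u ≠ 0 ∧ 0 ≤ ⟪u, (σ : V n)⟫}.indicator
        (fun u => Φ ((2:ℝ)⁻¹ • (u + ‖u‖ • (σ : V n)), σ) *
          φ (vs + (2:ℝ)⁻¹ • (u + ‖u‖ • (σ : V n)))) (v - vs)) ∂(sphMeas n) ≤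
    2 ^ n * ∫⁻ w : V n, φ w * ∫⁻ vs : V n, G vs *
      ∫⁻ σ : Metric.sphere (0 : V n) 1, Φ (w - vs, σ) ∂(sphMeas n) := by
  -- joint measurability
  set J : V n × V n × Metric.sphere (0 : V n) 1 → ℝ≥0∞ := fun q =>
      G q.2.1 * ({u : V n | u ≠ 0 ∧ 0 ≤ ⟪u, (q.2.2 : V n)⟫}.indicator
        (fun u => Φ ((2:ℝ)⁻¹ • (u + ‖u‖ • (q.2.2 : V n)), q.2.2) *
          φ (q.2.1 + (2:ℝ)⁻¹ • (u + ‖u‖ • (q.2.2 : V n)))) (q.1 - q.2.1)) with hJ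
  have hJm : Measurable J := by
    have hA : MeasurableSet {q : V n × V n × Metric.sphere (0 : V n) 1 |
        q.1 - q.2.1 ≠ 0 ∧ 0 ≤ ⟪q.1 - q.2.1, (q.2.2 : V n)⟫} := by
      have h1 : MeasurableSet {q : V n × V n × Metric.sphere (0 : V n) 1 |
        0 ≤ ⟪q.1 - q.2.1, (q.2.2 : V n)⟫} := by
        apply measurableSet_le <;> fun_prop
      have h2 : MeasurableSet {q : V n × V n × Metric.sphere (0 : V n) 1 |
        q.1 - q.2.1 = 0} := by
        apply measurableSet_eq_fun <;> fun_prop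
      exact h2.compl.inter h1
    have hB : Measurable (fun q : V n × V n × Metric.sphere (0 : V n) 1 =>
        Φ ((2:ℝ)⁻¹ • ((q.1 - q.2.1) + ‖q.1 - q.2.1‖ • (q.2.2 : V n)), q.2.2) *
          φ (q.2.1 + (2:ℝ)⁻¹ • ((q.1 - q.2.1) + ‖q.1 - q.2.1‖ • (q.2.2 : V n)))) := by
      fun_prop
    have := (hG.comp (measurable_fst.comp measurable_snd)).mul (hB.indicator hA)
    exact this
  calc ∫⁻ v : V n, ∫⁻ vs : V n, ∫⁻ σ : Metric.sphere (0 : V n) 1, J (v, vs, σ) ∂(sphMeas n)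
      = ∫⁻ vs : V n, ∫⁻ v : V n, ∫⁻ σ : Metric.sphere (0 : V n) 1, J (v, vs, σ) ∂(sphMeas n) := by
        apply lintegral_lintegral_swap
        apply Measurable.aemeasurable
        have : Measurable (fun q : (V n × V n) × Metric.sphere (0 : V n) 1 => J (q.1.1, q.1.2, q.2)) := by
          fun_prop
        exact this.lintegral_prod_right'
    _ = ∫⁻ vs : V n, ∫⁻ σ : Metric.sphere (0 : V n) 1, ∫⁻ v : V n, J (v, vs, σ) ∂volume ∂(sphMeas n) := by
        congr 1; ext vs
        apply lintegral_lintegral_swap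
        apply Measurable.aemeasurable
        fun_prop
    _ ≤ ∫⁻ vs : V n, ∫⁻ σ : Metric.sphere (0 : V n) 1, 2 ^ n * (∫⁻ w : V n, G vs * (Φ (w - vs, σ) * φ w)) ∂(sphMeas n) := by
        refine lintegral_mono fun vs => lintegral_mono fun σ => ?_
        have hσ : ‖(σ : V n)‖ = 1 := by simp
        have hS : MeasurableSet {u : V n | u ≠ 0 ∧ 0 ≤ ⟪u, (σ : V n)⟫} := by
          have h1 : MeasurableSet {u : V n | 0 ≤ ⟪u, (σ : V n)⟫} := by
            apply measurableSet_le <;> fun_prop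
          exact (measurableSet_singleton (0 : V n)).compl.inter h1
        have h1 := cov (σ : V n) hσ (fun w => G vs * (Φ (w, σ) * φ (vs + w)))
        have h2 : ∫⁻ w : V n, G vs * (Φ (w - vs, σ) * φ w) = ∫⁻ w : V n, G vs * (Φ (w, σ) * φ (vs + w)) := by
          rw [← lintegral_sub_right_eq_self (fun w => G vs * (Φ (w, σ) * φ (vs + w))) vs]
          simp
        rw [h2]
        refine le_trans (le_of_eq ?_) h1
        rw [← lintegral_indicator hS,
          ← lintegral_sub_right_eq_self (fun u => indicator _ _ u) vs]
        congr 1; ext v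
        simp only [hJ]
        by_cases hv : v - vs ∈ {u : V n | u ≠ 0 ∧ 0 ≤ ⟪u, (σ : V n)⟫}
        · rw [indicator_of_mem hv, indicator_of_mem hv]
        · rw [indicator_of_notMem hv, indicator_of_notMem hv, mul_zero]
    _ = 2 ^ n * ∫⁻ vs : V n, ∫⁻ σ : Metric.sphere (0 : V n) 1, ∫⁻ w : V n, G vs * (Φ (w - vs, σ) * φ w) ∂volume ∂(sphMeas n) := by
        rw [← lintegral_const_mul' _ _ (by simp)]
        congr 1; ext vs
        rw [lintegral_const_mul' _ _ (by simp)]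
    _ = 2 ^ n * ∫⁻ vs : V n, ∫⁻ w : V n, ∫⁻ σ : Metric.sphere (0 : V n) 1, G vs * (Φ (w - vs, σ) * φ w) ∂(sphMeas n) := by
        congr 2; ext vs
        apply lintegral_lintegral_swap
        apply Measurable.aemeasurable
        fun_prop
    _ = 2 ^ n * ∫⁻ w : V n, ∫⁻ vs : V n, ∫⁻ σ : Metric.sphere (0 : V n) 1, G vs * (Φ (w - vs, σ) * φ w) ∂(sphMeas n) := by
        congr 1
        apply lintegral_lintegral_swap
        apply Measurable.aemeasurable
        have : Measurable (fun q : (V n × V n) × Metric.sphere (0 : V n) 1 =>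
            G q.1.1 * (Φ (q.1.2 - q.1.1, q.2) * φ q.1.2)) := by
          fun_prop
        exact this.lintegral_prod_right'
    _ = _ := by
        congr 2; ext w
        have hI : Measurable (fun vs : V n => ∫⁻ σ : Metric.sphere (0 : V n) 1, Φ (w - vs, σ) ∂(sphMeas n)) := by
          have : Measurable (fun q : V n × Metric.sphere (0 : V n) 1 => Φ (w - q.1, q.2)) := by
            fun_prop
          exact this.lintegral_prod_right'
        rw [← lintegral_const_mul _ (by fun_prop)]
        congr 1; ext vs
        rw [lintegral_const_mul _ (by fun_prop), lintegral_mul_const _ (by fun_prop)]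
        ring


lemma sphere_int_bound {n : ℕ} (hn : 2 ≤ n) {s γ c D : ℝ} (hs : s ∈ Set.Ioo (0:ℝ) 1)
    (hc : 0 < c) (hD : 0 < D) (w : V n) :
    ∫⁻ σ : Metric.sphere (0 : V n) 1,
      ({q : V n × Metric.sphere (0 : V n) 1 | ‖‖q.1‖ • (q.2 : V n) - q.1‖ ≤ 2 * D}.indicator
        (fun q => ENNReal.ofReal (c * ‖q.1‖ ^ γ * (4 * ‖q.1‖ / D) ^ ((n:ℝ) - 1 + 2 * s))) (w, σ))
        ∂(sphMeas n) ≤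
    ENNReal.ofReal ((c * 4 ^ ((n:ℝ) - 1 + 2 * s) * 2 ^ n * (volume (ball (0 : V n) 1)).toReal
      * 2 ^ (n - 1)) * D ^ (-(2 * s)) * ‖w‖ ^ (γ + 2 * s)) := by
  have hn2 : (2:ℝ) ≤ n := by exact_mod_cast hn
  have hm : 0 < (n:ℝ) - 1 + 2 * s := by linarith [hs.1]
  by_cases hw : w = 0
  · subst hw
    refine le_trans (le_of_eq ?_) zero_le
    rw [lintegral_eq_zero_of_ae_eq_zero]
    refine Filter.Eventually.of_forall fun σ => ?_
    simp [indicator, Real.zero_rpow hm.ne']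
  have hwp : 0 < ‖w‖ := norm_pos_iff.2 hw
  set K := c * ‖w‖ ^ γ * (4 * ‖w‖ / D) ^ ((n:ℝ) - 1 + 2 * s) with hK
  have hK0 : 0 ≤ K := by positivity
  have hcap := cap_bound n hn (‖w‖⁻¹ • w) (by rw [norm_smul, norm_inv, norm_norm, inv_mul_cancel₀ hwp.ne'])
    (2 * D / ‖w‖) (by positivity)
  set S : Set (Metric.sphere (0 : V n) 1) := {σ | ‖(σ : V n) - ‖w‖⁻¹ • w‖ ≤ 2 * D / ‖w‖} with hS
  have hSm : MeasurableSet S := by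
    apply measurableSet_le <;> fun_prop
  calc _ = ∫⁻ σ : Metric.sphere (0 : V n) 1, S.indicator (fun _ => ENNReal.ofReal K) σ ∂(sphMeas n) := by
        congr 1; ext σ
        have : ((w, σ) ∈ {q : V n × Metric.sphere (0 : V n) 1 | ‖‖q.1‖ • (q.2 : V n) - q.1‖ ≤ 2 * D}) ↔ σ ∈ S := by
          simp only [hS, mem_ofPred_eq]
          have e : ‖w‖ • (σ : V n) - w = ‖w‖ • ((σ : V n) - ‖w‖⁻¹ • w) := by
            rw [smul_sub, smul_smul, mul_inv_cancel₀ hwp.ne', one_smul]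
          rw [e, norm_smul, norm_norm, le_div_iff₀ hwp, mul_comm]
        by_cases hσ : σ ∈ S
        · rw [indicator_of_mem (this.2 hσ), indicator_of_mem hσ]
        · rw [indicator_of_notMem (fun h => hσ (this.1 h)), indicator_of_notMem hσ]
    _ = ENNReal.ofReal K * sphMeas n S := by rw [lintegral_indicator_const hSm]
    _ ≤ ENNReal.ofReal K * _ := mul_le_mul' le_rfl hcap
    _ = _ := by
        rw [← ENNReal.ofReal_mul hK0]
        congr 1
        have hq : 0 < ‖w‖ / D := by positivity
        have e1 : (4 * ‖w‖ / D) ^ ((n:ℝ) - 1 + 2 * s) =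
            4 ^ ((n:ℝ) - 1 + 2 * s) * ((‖w‖ / D) ^ (n - 1) * (‖w‖ ^ (2 * s) * D ^ (-(2 * s)))) := by
          rw [mul_div_assoc, Real.mul_rpow (by norm_num) hq.le, Real.rpow_add hq,
            Real.div_rpow hwp.le hD.le (2 * s), Real.rpow_neg hD.le, ← Real.rpow_natCast]
          rw [Nat.cast_sub (by omega)]
          simp [div_eq_mul_inv]
        have e2 : (2 * D / ‖w‖) ^ (n - 1) = 2 ^ (n - 1) * ((‖w‖ / D) ^ (n - 1))⁻¹ := by
          rw [← inv_pow, ← mul_pow]; congr 1; field_simp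
        rw [hK, e1, e2, Real.rpow_add hwp]
        field_simp

/-- Proposition 2.2 (trivial estimate for the piece `D^k_*`). -/
theorem trivial_estimate_star
    (n : ℕ) (hn : 2 ≤ n) (s γ CΦ cb : ℝ)
    (hs : s ∈ Set.Ioo (0:ℝ) 1) (hγ : -(n:ℝ) < γ) (hCΦ : 0 < CΦ) (hcb : 0 < cb) :
    ∃ C : ℝ, 0 < C ∧
      ∀ b : ℝ → ℝ, KernelAssumptions n s cb b →
      ∀ g : V n → ℝ, Measurable g →
      ∀ Cg : ℝ, 0 < Cg → AssumptionU s γ Cg g →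
      ∀ f h : V n → ℝ, Measurable f → Measurable h →
      ∀ k : ℤ, ∀ χ : ℝ → ℝ, Measurable χ → (∀ t, χ t ∈ Set.Icc (0:ℝ) 1) →
        (∀ t : ℝ, t ∉ Set.Icc ((2:ℝ) ^ (-k - 1)) ((2:ℝ) ^ (-k)) → χ t = 0) →
        (∫⁻ v : V n, ∫⁻ vs : V n, ∫⁻ σ : Metric.sphere (0 : V n) 1,
            ENNReal.ofReal (Bker CΦ γ b v vs σ * χ ‖vprime v vs σ - v‖ *
              |g vs| * |f (vprime v vs σ) * h (vprime v vs σ)|) ∂(sphMeas n)) ≤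
          ENNReal.ofReal (C * Cg * (2:ℝ) ^ (2 * s * (k:ℝ))) *
            L2e (γ + 2 * s) f ^ (2⁻¹ : ℝ) * L2e (γ + 2 * s) h ^ (2⁻¹ : ℝ) := by
  have hn2 : (2:ℝ) ≤ n := by exact_mod_cast hn
  set c := CΦ * (2 ^ |γ| * cb⁻¹) with hc
  have hc0 : 0 < c := by positivity
  have hvB : 0 < (volume (ball (0 : V n) 1)).toReal :=
    ENNReal.toReal_pos (measure_ball_pos _ _ one_pos).ne' measure_ball_lt_top.ne
  set C1 := c * 4 ^ ((n:ℝ) - 1 + 2 * s) * 2 ^ n * (volume (ball (0 : V n) 1)).toReal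
      * 2 ^ (n - 1) with hC1
  have hC10 : 0 < C1 := by positivity
  refine ⟨2 ^ n * C1, by positivity, ?_⟩
  intro b hb g hg Cg hCg hU f h hf hh k χ hχm hχ hχ0
  set D : ℝ := (2:ℝ) ^ (-k) with hD
  have hD0 : 0 < D := by positivity
  have hD2 : (2:ℝ) ^ (-k - 1) = D / 2 := by
    rw [zpow_sub_one₀ (by norm_num)]; rfl
  rw [hD2] at hχ0
  have hDs : D ^ (-(2 * s)) = (2:ℝ) ^ (2 * s * (k:ℝ)) := by
    rw [hD, ← Real.rpow_intCast, ← Real.rpow_mul (by norm_num)]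
    congr 1; push_cast; ring
  set Φ : V n × Metric.sphere (0 : V n) 1 → ℝ≥0∞ :=
    {q : V n × Metric.sphere (0 : V n) 1 | ‖‖q.1‖ • (q.2 : V n) - q.1‖ ≤ 2 * D}.indicator
        (fun q => ENNReal.ofReal (c * ‖q.1‖ ^ γ * (4 * ‖q.1‖ / D) ^ ((n:ℝ) - 1 + 2 * s))) with hΦ
  have hΦm : Measurable Φ := by
    apply Measurable.indicator
    · fun_prop
    · apply measurableSet_le <;> fun_prop
  calc _ ≤ ∫⁻ v : V n, ∫⁻ vs : V n, ∫⁻ σ : Metric.sphere (0 : V n) 1,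
      ENNReal.ofReal |g vs| * ({u : V n | u ≠ 0 ∧ 0 ≤ ⟪u, (σ : V n)⟫}.indicator
        (fun u => Φ ((2:ℝ)⁻¹ • (u + ‖u‖ • (σ : V n)), σ) *
          (fun w => ENNReal.ofReal |f w * h w|) (vs + (2:ℝ)⁻¹ • (u + ‖u‖ • (σ : V n)))) (v - vs))
            ∂(sphMeas n) := by
        refine lintegral_mono fun v => lintegral_mono fun vs => lintegral_mono fun σ => ?_
        have hσ : ‖(σ : V n)‖ = 1 := by simp
        set u := v - vs with hu
        set w := (2:ℝ)⁻¹ • (u + ‖u‖ • (σ : V n)) with hw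
        have hv' : vprime v vs σ = vs + w := by
          rw [vprime, hw, hu]; module
        have hv'' : vs + w - v = w - u := by rw [hu]; abel
        rw [hv', hv'', Bker, ← hu]
        have hpt := pointwise_bound (γ := γ) hn hs hcb hb hD0 hχ hχ0 u σ w hσ hw
        have hle : CΦ * ‖u‖ ^ γ * b ⟪‖u‖⁻¹ • u, (σ : V n)⟫ * χ ‖w - u‖ * |g vs| *
              |f (vs + w) * h (vs + w)| = CΦ * (‖u‖ ^ γ * b ⟪‖u‖⁻¹ • u, (σ : V n)⟫ * χ ‖w - u‖) *
                (|g vs| * |f (vs + w) * h (vs + w)|) := by ring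
        rw [hle]
        have hle2 := mul_le_mul_of_nonneg_right (mul_le_mul_of_nonneg_left hpt hCΦ.le)
          (by positivity : 0 ≤ |g vs| * |f (vs + w) * h (vs + w)|)
        refine (ENNReal.ofReal_le_ofReal hle2).trans ?_
        split_ifs with hcond
        · have hmem : u ∈ {u : V n | u ≠ 0 ∧ 0 ≤ ⟪u, (σ : V n)⟫} := hcond.1
          have hmem2 : (w, σ) ∈ {q : V n × Metric.sphere (0 : V n) 1 |
            ‖‖q.1‖ • (q.2 : V n) - q.1‖ ≤ 2 * D} := hcond.2
          rw [indicator_of_mem hmem, ← hw, hΦ, indicator_of_mem hmem2,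
            ← ENNReal.ofReal_mul (by positivity), ← ENNReal.ofReal_mul (by positivity)]
          apply le_of_eq; congr 1
          rw [hc]; ring
        · simp
    _ ≤ 2 ^ n * ∫⁻ w : V n, ENNReal.ofReal |f w * h w| * ∫⁻ vs : V n, ENNReal.ofReal |g vs| *
          ∫⁻ σ : Metric.sphere (0 : V n) 1, Φ (w - vs, σ) ∂(sphMeas n) :=
        swap_step Φ hΦm (fun vs => ENNReal.ofReal |g vs|) (fun w => ENNReal.ofReal |f w * h w|)
          (by fun_prop) (by fun_prop)
    _ ≤ 2 ^ n * ∫⁻ w : V n, ENNReal.ofReal (C1 * Cg * D ^ (-(2 * s))) *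
          (ENNReal.ofReal |f w * h w| * ENNReal.ofReal (jap w ^ (γ + 2 * s))) := by
        refine mul_le_mul' le_rfl (lintegral_mono fun w => ?_)
        calc _ ≤ ENNReal.ofReal |f w * h w| * ∫⁻ vs : V n, ENNReal.ofReal (C1 * D ^ (-(2 * s))) *
              ENNReal.ofReal (‖w - vs‖ ^ (γ + 2 * s) *
                jap vs ^ (if s < 2⁻¹ then (1:ℝ) else 2) * |g vs|) := by
              refine mul_le_mul' le_rfl (lintegral_mono fun vs => ?_)
              refine (mul_le_mul' le_rfl (sphere_int_bound hn hs hc0 hD0 (w - vs))).trans ?_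
              rw [← ENNReal.ofReal_mul (by positivity), ← ENNReal.ofReal_mul (by positivity)]
              apply ENNReal.ofReal_le_ofReal
              have hj : 1 ≤ jap vs ^ (if s < 2⁻¹ then (1:ℝ) else 2) :=
                Real.one_le_rpow (one_le_jap vs) (by split_ifs <;> norm_num)
              have hX : 0 ≤ |g vs| * (C1 * D ^ (-(2 * s)) * ‖w - vs‖ ^ (γ + 2 * s)) := by positivity
              calc _ ≤ (|g vs| * (C1 * D ^ (-(2 * s)) * ‖w - vs‖ ^ (γ + 2 * s))) *
                    jap vs ^ (if s < 2⁻¹ then (1:ℝ) else 2) := le_mul_of_one_le_right hX hj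
                _ = _ := by ring
          _ ≤ ENNReal.ofReal |f w * h w| * (ENNReal.ofReal (C1 * D ^ (-(2 * s))) *
                ENNReal.ofReal (Cg * jap w ^ (γ + 2 * s))) := by
              rw [lintegral_const_mul' _ _ (by simp)]
              refine mul_le_mul' le_rfl (mul_le_mul' le_rfl ?_)
              exact hU w (γ + 2 * s) ⟨by linarith [hs.1], le_rfl⟩
          _ = _ := by
              have := jap_pos w
              rw [← ENNReal.ofReal_mul (by positivity), ← ENNReal.ofReal_mul (by positivity),
                ← ENNReal.ofReal_mul (by positivity), ← ENNReal.ofReal_mul (by positivity)]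
              congr 1; ring
    _ = ENNReal.ofReal (2 ^ n * C1 * Cg * (2:ℝ) ^ (2 * s * (k:ℝ))) *
          ∫⁻ w : V n, ENNReal.ofReal |f w * h w| * ENNReal.ofReal (jap w ^ (γ + 2 * s)) := by
        rw [lintegral_const_mul' _ _ (by simp), ← mul_assoc]
        congr 1
        have : (2:ℝ≥0∞) ^ n = ENNReal.ofReal (2 ^ n) := by
          rw [ENNReal.ofReal_pow (by norm_num)]; simp
        rw [this, ← ENNReal.ofReal_mul (by positivity), hDs]
        congr 1; ring
    _ ≤ _ := by
        rw [mul_assoc (ENNReal.ofReal _)]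
        refine mul_le_mul' le_rfl ?_
        exact cs_bound _ f h hf hh
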